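/- Lower bound for additive functionals up to return times (Lemma 3.7 of the paper). Let κ = (κ_t)_{t≥0} be a [0,∞)-valued continuous adapted process with limsup_{t→∞} κ_t = ∞ almost surely. Suppose there exist p, ℓ, C ∈ (0,∞) such that for all r ∈ (ℓ,∞): (a) the process (κ_{t∧λ_ℓ∧ρ_r}^p)_{t≥0} is an (F_t)-submartingale; and (b) for every q ∈ (0,1), setting r_q := r/(1−q), the process (κ_{(ρ_{r_q}+t)∧λ_{r,ρ_{r_q}}}^{−2} − C·∫_{ρ_{r_q}}^{(ρ_{r_q}+t)∧λ_{r,ρ_{r_q}}} κ_u^{−4} du)_{t≥0} is an (F_{ρ_{r_q}+t})-supermartingale. Then for every non-decreasing measurable function h : [0,∞) → [0,∞), every r ∈ (ℓ,∞), every q ∈ (0,1) and every ε ∈ (0, C⁻¹q(1−q)], almost surely on the event {κ₀ > ℓ}: P(∫₀^{λ_ℓ} h(κ_s) ds ≥ ε·h(r)·r² | F₀) ≥ q·min{(κ₀^p − ℓ^p)·(1−q)^p·r^{−p}, 1}. -/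

import Mathlib

open MeasureTheory Filter Set
open scoped NNReal ENNReal

variable {Ω : Type*}

/-- First time after the stopping time `T` at which `κ` drops to level `ℓ` or below
(`∞` if this never happens, or if `T = ∞`). -/
noncomputable def hitBelow (κ : ℝ≥0 → Ω → ℝ≥0) (ℓ : ℝ≥0) (T : Ω → ℝ≥0∞) (ω : Ω) : ℝ≥0∞ :=
  T ω + sInf ((fun u : ℝ≥0 => (u : ℝ≥0∞)) ''
    {u : ℝ≥0 | T ω ≠ ⊤ ∧ κ ((T ω).toNNReal + u) ω ≤ ℓ})

/-- First time after the stopping time `T` at which `κ` rises to level `r` or above. -/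
noncomputable def hitAbove (κ : ℝ≥0 → Ω → ℝ≥0) (r : ℝ≥0) (T : Ω → ℝ≥0∞) (ω : Ω) : ℝ≥0∞ :=
  T ω + sInf ((fun u : ℝ≥0 => (u : ℝ≥0∞)) ''
    {u : ℝ≥0 | T ω ≠ ⊤ ∧ r ≤ κ ((T ω).toNNReal + u) ω})

/-- `λ_ℓ := λ_{ℓ,0}`. -/
noncomputable def lamZero (κ : ℝ≥0 → Ω → ℝ≥0) (ℓ : ℝ≥0) : Ω → ℝ≥0∞ :=
  hitBelow κ ℓ (fun _ => 0)

/-- `ρ_r := ρ_{r,0}`. -/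
noncomputable def rhoZero (κ : ℝ≥0 → Ω → ℝ≥0) (r : ℝ≥0) : Ω → ℝ≥0∞ :=
  hitAbove κ r (fun _ => 0)

/-- The σ-algebra `F_T` at the stopping time `T`. -/
noncomputable def stoppedSigma {m0 : MeasurableSpace Ω} (ℱ : Filtration ℝ≥0 m0)
    (T : Ω → ℝ≥0∞) : MeasurableSpace Ω :=
  MeasurableSpace.generateFrom
    {A | ∀ t : ℝ≥0, MeasurableSet[ℱ t] (A ∩ {ω | T ω ≤ (t : ℝ≥0∞)})}

/-- `ρ_{r_q} := ρ_{r/(1-q)}`, the first passage of `κ` to the level `r/(1-q)`. -/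
noncomputable def rhoRq (κ : ℝ≥0 → Ω → ℝ≥0) (r q : ℝ≥0) : Ω → ℝ≥0∞ :=
  hitAbove κ (r / (1 - q)) (fun _ => 0)

/-- `λ_{r, ρ_{r_q}}`, the first return of `κ` below level `r` after `ρ_{r_q}`. -/
noncomputable def lamAfterRho (κ : ℝ≥0 → Ω → ℝ≥0) (r q : ℝ≥0) : Ω → ℝ≥0∞ :=
  hitBelow κ r (rhoRq κ r q)

/-- The process `κ_{(ρ_{r_q}+t) ∧ λ_{r,ρ_{r_q}}}^{-2}
− C ∫_{ρ_{r_q}}^{(ρ_{r_q}+t) ∧ λ_{r,ρ_{r_q}}} κ_u^{-4} du`. -/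
noncomputable def excursionProc (κ : ℝ≥0 → Ω → ℝ≥0) (C r q : ℝ≥0) (t : ℝ≥0) (ω : Ω) : ℝ :=
  ((κ ((min (rhoRq κ r q ω + (t : ℝ≥0∞)) (lamAfterRho κ r q ω)).toNNReal) ω : ℝ) ^ 2)⁻¹
    - (C : ℝ) * ∫ u in Set.Ioc (((rhoRq κ r q ω).toNNReal : ℝ))
        (((min (rhoRq κ r q ω + (t : ℝ≥0∞)) (lamAfterRho κ r q ω)).toNNReal : ℝ)),
        ((κ u.toNNReal ω : ℝ) ^ 4)⁻¹

/-- The additive functional `∫₀^{λ_ℓ} h(κ_s) ds`, as a Lebesgue integral in `[0,∞]`. -/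
noncomputable def addFunToLam (κ : ℝ≥0 → Ω → ℝ≥0) (h : ℝ≥0 → ℝ≥0) (ℓ : ℝ≥0) (ω : Ω) :
    ℝ≥0∞ :=
  ∫⁻ u in {u : ℝ | 0 ≤ u ∧ ENNReal.ofReal u ≤ lamZero κ ℓ ω},
    (h (κ u.toNNReal ω) : ℝ≥0∞)

theorem coe_lt_sInf_image_coe_iff {S : Set ℝ≥0} (hS : IsClosed S) (t : ℝ≥0) :
    (t : ℝ≥0∞) < sInf ((fun u : ℝ≥0 => (u : ℝ≥0∞)) '' S) ↔ ∀ s ≤ t, s ∉ S := by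
  constructor
  · intro h s hst hs
    exact absurd (h.trans_le (sInf_le (mem_image_of_mem _ hs)))
      (not_lt.2 (ENNReal.coe_le_coe.2 hst))
  · intro h
    rcases S.eq_empty_or_nonempty with rfl | hne
    · simp
    · have hmem : sInf S ∈ S := hS.csInf_mem hne (OrderBot.bddBelow S)
      have hlt : t < sInf S := lt_of_not_ge fun hle => h _ hle hmem
      refine (ENNReal.coe_lt_coe.2 hlt).trans_le (le_sInf ?_)
      rintro _ ⟨u, hu, rfl⟩
      exact ENNReal.coe_le_coe.2 (csInf_le (OrderBot.bddBelow S) hu)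

theorem add_lt_hitBelow_iff {κ : ℝ≥0 → Ω → ℝ≥0} {ω : Ω} (hc : Continuous fun t => κ t ω)
    {ℓ a : ℝ≥0} {T : Ω → ℝ≥0∞} (hT : T ω = a) (s : ℝ≥0) :
    ((a + s : ℝ≥0) : ℝ≥0∞) < hitBelow κ ℓ T ω ↔ ∀ u ≤ s, ℓ < κ (a + u) ω := by
  have hcl : IsClosed {u : ℝ≥0 | κ (a + u) ω ≤ ℓ} :=
    isClosed_le (hc.comp (continuous_const.add continuous_id)) continuous_const
  have h := coe_lt_sInf_image_coe_iff hcl s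
  simp only [hitBelow, hT, ne_eq, ENNReal.coe_ne_top, not_false_eq_true, true_and,
    ENNReal.toNNReal_coe, ENNReal.coe_add]
  rw [ENNReal.add_lt_add_iff_left ENNReal.coe_ne_top, h]
  simp

theorem lt_lamZero_iff {κ : ℝ≥0 → Ω → ℝ≥0} {ω : Ω} (hc : Continuous fun t => κ t ω)
    {ℓ : ℝ≥0} (t : ℝ≥0) :
    (t : ℝ≥0∞) < lamZero κ ℓ ω ↔ ∀ s ≤ t, ℓ < κ s ω := by
  simpa [lamZero] using add_lt_hitBelow_iff (a := 0) (T := fun _ => 0) hc (ℓ := ℓ) rfl t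

theorem lt_rhoZero_iff {κ : ℝ≥0 → Ω → ℝ≥0} {ω : Ω} (hc : Continuous fun t => κ t ω)
    {r : ℝ≥0} (t : ℝ≥0) :
    (t : ℝ≥0∞) < rhoZero κ r ω ↔ ∀ s ≤ t, κ s ω < r := by
  have hcl : IsClosed {u : ℝ≥0 | r ≤ κ u ω} := isClosed_le continuous_const hc
  have h := coe_lt_sInf_image_coe_iff hcl t
  simp only [rhoZero, hitAbove, ne_eq, ENNReal.zero_ne_top, not_false_eq_true, true_and,
    ENNReal.toNNReal_zero, zero_add]
  rw [h]
  simp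

/-- At its first passage time above `r`, the path is at level at least `r`. -/
theorem le_of_rhoZero_eq {κ : ℝ≥0 → Ω → ℝ≥0} {ω : Ω} (hc : Continuous fun t => κ t ω)
    {r a : ℝ≥0} (ha : rhoZero κ r ω = a) : r ≤ κ a ω := by
  by_contra! hlt
  have h : ¬ (a : ℝ≥0∞) < rhoZero κ r ω := by simp [ha]
  rw [lt_rhoZero_iff hc] at h
  push Not at h
  obtain ⟨s, hsa, hs⟩ := h
  have hne : s < a := lt_of_le_of_ne hsa (by rintro rfl; exact absurd hs (not_le.2 hlt))
  have : (s : ℝ≥0∞) < rhoZero κ r ω := by rw [ha]; exact_mod_cast hne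
  exact absurd ((lt_rhoZero_iff hc s).1 this s le_rfl) (not_lt.2 hs)

/-- At its first passage time below `ℓ`, the path is at level at most `ℓ`. -/
theorem le_of_hitBelow_eq {κ : ℝ≥0 → Ω → ℝ≥0} {ω : Ω} (hc : Continuous fun t => κ t ω)
    {ℓ a s : ℝ≥0} {T : Ω → ℝ≥0∞} (hT : T ω = a) (hs : hitBelow κ ℓ T ω = (a + s : ℝ≥0)) :
    κ (a + s) ω ≤ ℓ := by
  by_contra! hlt
  have h : ¬ ((a + s : ℝ≥0) : ℝ≥0∞) < hitBelow κ ℓ T ω := by rw [hs]; exact lt_irrefl _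
  rw [add_lt_hitBelow_iff hc hT] at h
  push Not at h
  obtain ⟨u, hus, hu⟩ := h
  have hne : u < s := lt_of_le_of_ne hus (by rintro rfl; exact absurd hu (not_le.2 hlt))
  have : ((a + u : ℝ≥0) : ℝ≥0∞) < hitBelow κ ℓ T ω := by
    rw [hs]; exact ENNReal.coe_lt_coe.2 (by gcongr)
  exact absurd ((add_lt_hitBelow_iff hc hT u).1 this u le_rfl) (not_lt.2 hu)

theorem le_of_lamZero_eq {κ : ℝ≥0 → Ω → ℝ≥0} {ω : Ω} (hc : Continuous fun t => κ t ω)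
    {ℓ a : ℝ≥0} (ha : lamZero κ ℓ ω = a) : κ a ω ≤ ℓ := by
  simpa using le_of_hitBelow_eq (a := 0) (s := a) (T := fun _ => 0) hc rfl
    (by simpa [lamZero] using ha)

theorem le_of_forall_lt_le {f : ℝ≥0 → ℝ≥0} (hf : Continuous f) {a b c : ℝ≥0} (hab : a < b)
    (h : ∀ s, a ≤ s → s < b → f s ≤ c) : f b ≤ c := by
  have hcl : closure (Ico a b) ⊆ {s | f s ≤ c} :=
    closure_minimal (fun s hs => h s hs.1 hs.2) (isClosed_le hf continuous_const)
  rw [closure_Ico hab.ne] at hcl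
  exact hcl (right_mem_Icc.2 hab.le)

theorem ge_of_forall_lt_ge {f : ℝ≥0 → ℝ≥0} (hf : Continuous f) {a b c : ℝ≥0} (hab : a < b)
    (h : ∀ s, a ≤ s → s < b → c ≤ f s) : c ≤ f b := by
  have hcl : closure (Ico a b) ⊆ {s | c ≤ f s} :=
    closure_minimal (fun s hs => h s hs.1 hs.2) (isClosed_le continuous_const hf)
  rw [closure_Ico hab.ne] at hcl
  exact hcl (right_mem_Icc.2 hab.le)

theorem measurableSet_forall_le_pos {m : MeasurableSpace Ω} {f : ℝ≥0 → Ω → ℝ} {t : ℝ≥0}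
    (hf : ∀ s ≤ t, Measurable (f s)) (hc : ∀ ω, Continuous fun s => f s ω) :
    MeasurableSet {ω | ∀ s ≤ t, 0 < f s ω} := by
  have heq : {ω | ∀ s ≤ t, 0 < f s ω} =
      ⋃ n : ℕ, ⋂ i : ℕ,
        {ω | 1 / ((n : ℝ) + 1) ≤ f (min (TopologicalSpace.denseSeq ℝ≥0 i) t) ω} := by
    ext ω
    simp only [mem_ofPred_eq, mem_iUnion, mem_iInter]
    constructor
    · intro h
      obtain ⟨x, hx, hmin⟩ := isCompact_Icc.exists_isMinOn
        (⟨0, left_mem_Icc.2 (zero_le)⟩ : (Icc 0 t).Nonempty) (hc ω).continuousOn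
      obtain ⟨n, hn⟩ := exists_nat_one_div_lt (h x hx.2)
      exact ⟨n, fun i => hn.le.trans (hmin ⟨zero_le, min_le_right _ _⟩)⟩
    · rintro ⟨n, hn⟩ s hs
      have hcl : IsClosed {u : ℝ≥0 | 1 / ((n : ℝ) + 1) ≤ f (min u t) ω} :=
        isClosed_le continuous_const ((hc ω).comp (continuous_id.min continuous_const))
      have : 1 / ((n : ℝ) + 1) ≤ f (min s t) ω :=
        isClosed_property (TopologicalSpace.denseRange_denseSeq ℝ≥0) hcl hn s
      rw [min_eq_left hs] at this
      exact lt_of_lt_of_le (by positivity) this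
  rw [heq]
  exact MeasurableSet.iUnion fun n => MeasurableSet.iInter fun i =>
    measurableSet_le measurable_const (hf _ (min_le_right _ _))

section HittingTimes

variable {m0 : MeasurableSpace Ω} {ℱ : Filtration ℝ≥0 m0} {κ : ℝ≥0 → Ω → ℝ≥0}

theorem measurableSet_lt_lamZero (hadapt : ∀ t : ℝ≥0, Measurable[ℱ t] (κ t))
    (hcont : ∀ ω, Continuous fun t => κ t ω) (ℓ t : ℝ≥0) :
    MeasurableSet[ℱ t] {ω | (t : ℝ≥0∞) < lamZero κ ℓ ω} := by
  have h := measurableSet_forall_le_pos (m := ℱ t) (t := t)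
    (f := fun s ω => (κ s ω : ℝ) - ℓ)
    (fun s hs => by
      have := (hadapt s).mono (ℱ.mono hs) le_rfl
      fun_prop)
    (fun ω => by have := hcont ω; fun_prop)
  convert h using 2
  ext ω
  simp only [lt_lamZero_iff (hcont ω), sub_pos, NNReal.coe_lt_coe]

theorem measurableSet_lt_rhoZero (hadapt : ∀ t : ℝ≥0, Measurable[ℱ t] (κ t))
    (hcont : ∀ ω, Continuous fun t => κ t ω) (r t : ℝ≥0) :
    MeasurableSet[ℱ t] {ω | (t : ℝ≥0∞) < rhoZero κ r ω} := by
  have h := measurableSet_forall_le_pos (m := ℱ t) (t := t)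
    (f := fun s ω => (r : ℝ) - κ s ω)
    (fun s hs => by
      have := (hadapt s).mono (ℱ.mono hs) le_rfl
      fun_prop)
    (fun ω => by have := hcont ω; fun_prop)
  convert h using 2
  ext ω
  simp only [lt_rhoZero_iff (hcont ω), sub_pos, NNReal.coe_lt_coe]

theorem measurableSet_rhoZero_le (hadapt : ∀ t : ℝ≥0, Measurable[ℱ t] (κ t))
    (hcont : ∀ ω, Continuous fun t => κ t ω) (r t : ℝ≥0) :
    MeasurableSet[ℱ t] {ω | rhoZero κ r ω ≤ (t : ℝ≥0∞)} := by
  have h := (measurableSet_lt_rhoZero hadapt hcont r t).compl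
  convert h using 2
  ext ω
  simp

theorem measurable_of_measurableSet_coe_lt {f : Ω → ℝ≥0∞}
    (h : ∀ t : ℝ≥0, MeasurableSet {ω | (t : ℝ≥0∞) < f ω}) : Measurable f := by
  refine measurable_of_Ioi fun a => ?_
  induction a with
  | top => simp
  | coe a => exact h a

theorem measurable_lamZero (hadapt : ∀ t : ℝ≥0, Measurable[ℱ t] (κ t))
    (hcont : ∀ ω, Continuous fun t => κ t ω) (ℓ : ℝ≥0) : Measurable (lamZero κ ℓ) :=
  measurable_of_measurableSet_coe_lt fun t => ℱ.le t _ (measurableSet_lt_lamZero hadapt hcont ℓ t)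

theorem measurable_rhoZero (hadapt : ∀ t : ℝ≥0, Measurable[ℱ t] (κ t))
    (hcont : ∀ ω, Continuous fun t => κ t ω) (r : ℝ≥0) : Measurable (rhoZero κ r) :=
  measurable_of_measurableSet_coe_lt fun t => ℱ.le t _ (measurableSet_lt_rhoZero hadapt hcont r t)

theorem measurableSet_rhoZero_lt_lamZero_inter (hadapt : ∀ t : ℝ≥0, Measurable[ℱ t] (κ t))
    (hcont : ∀ ω, Continuous fun t => κ t ω) (r ℓ t : ℝ≥0) :
    MeasurableSet[ℱ t] ({ω | rhoZero κ r ω < lamZero κ ℓ ω} ∩ {ω | rhoZero κ r ω ≤ t}) := by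
  have heq : {ω | rhoZero κ r ω < lamZero κ ℓ ω} ∩ {ω | rhoZero κ r ω ≤ t} =
      {ω | rhoZero κ r ω ≤ t} ∩ ({ω | (t : ℝ≥0∞) < lamZero κ ℓ ω} ∪
        ⋃ i : ℕ, {ω | rhoZero κ r ω ≤ (min (TopologicalSpace.denseSeq ℝ≥0 i) t : ℝ≥0)} ∩
          {ω | ((min (TopologicalSpace.denseSeq ℝ≥0 i) t : ℝ≥0) : ℝ≥0∞) < lamZero κ ℓ ω}) := by
    ext ω
    simp only [mem_inter_iff, mem_ofPred_eq, mem_union, mem_iUnion]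
    constructor
    · rintro ⟨hlt, hle⟩
      refine ⟨hle, ?_⟩
      by_cases htl : (t : ℝ≥0∞) < lamZero κ ℓ ω
      · exact Or.inl htl
      · right
        obtain ⟨x, hx1, hx2⟩ := ENNReal.lt_iff_exists_nnreal_btwn.1 hlt
        obtain ⟨y, hy1, hy2⟩ := ENNReal.lt_iff_exists_nnreal_btwn.1 hx2
        obtain ⟨i, hi⟩ := (TopologicalSpace.denseRange_denseSeq ℝ≥0).exists_mem_open isOpen_Ioo
          (nonempty_Ioo.2 (ENNReal.coe_lt_coe.1 hy1))
        have hy : y ≤ t := by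
          exact_mod_cast (hy2.le.trans (not_lt.1 htl))
        refine ⟨i, ?_⟩
        rw [min_eq_left (hi.2.le.trans hy)]
        exact ⟨(hx1.trans (ENNReal.coe_lt_coe.2 hi.1)).le,
          (ENNReal.coe_lt_coe.2 hi.2).trans hy2⟩
    · rintro ⟨hle, h | ⟨i, h1, h2⟩⟩
      · exact ⟨hle.trans_lt h, hle⟩
      · exact ⟨h1.trans_lt h2, hle⟩
  rw [heq]
  refine (measurableSet_rhoZero_le hadapt hcont r t).inter
    ((measurableSet_lt_lamZero hadapt hcont ℓ t).union (MeasurableSet.iUnion fun i => ?_))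
  exact (ℱ.mono (min_le_right _ _) _ (measurableSet_rhoZero_le hadapt hcont r _)).inter
    (ℱ.mono (min_le_right _ _) _ (measurableSet_lt_lamZero hadapt hcont ℓ _))

theorem measurable_uncurry_path (hadapt : ∀ t : ℝ≥0, Measurable[ℱ t] (κ t))
    (hcont : ∀ ω, Continuous fun t => κ t ω) : Measurable (Function.uncurry κ) :=
  measurable_uncurry_of_continuous_of_measurable hcont fun t => (hadapt t).mono (ℱ.le t) le_rfl

theorem measurable_addFunToLam (hadapt : ∀ t : ℝ≥0, Measurable[ℱ t] (κ t))
    (hcont : ∀ ω, Continuous fun t => κ t ω) {h : ℝ≥0 → ℝ≥0} (hmeas : Measurable h) (ℓ : ℝ≥0) :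
    Measurable (addFunToLam κ h ℓ) := by
  have hκ := measurable_uncurry_path hadapt hcont
  have hlam := measurable_lamZero hadapt hcont ℓ
  have hset : MeasurableSet {z : Ω × ℝ | 0 ≤ z.2 ∧ ENNReal.ofReal z.2 ≤ lamZero κ ℓ z.1} :=
    (measurableSet_le measurable_const measurable_snd).inter
      (measurableSet_le (ENNReal.measurable_ofReal.comp measurable_snd) (hlam.comp measurable_fst))
  have hfun : Measurable fun z : Ω × ℝ => (h (κ z.2.toNNReal z.1) : ℝ≥0∞) :=
    (hmeas.comp (hκ.comp (f := fun z : Ω × ℝ => (z.2.toNNReal, z.1))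
      (by fun_prop))).coe_nnreal_ennreal
  have := (hfun.indicator hset).lintegral_prod_right' (ν := volume)
  convert this using 1
  ext ω
  exact (lintegral_indicator (measurable_prodMk_left (x := ω) hset) _).symm

theorem ae_rhoZero_ne_top {μ : Measure Ω} (hcont : ∀ ω, Continuous fun t => κ t ω)
    (hlimsup : ∀ᵐ ω ∂μ, Filter.limsup (fun t => (κ t ω : ℝ≥0∞)) atTop = ⊤) (r : ℝ≥0) :
    ∀ᵐ ω ∂μ, rhoZero κ r ω ≠ ⊤ := by
  filter_upwards [hlimsup] with ω hω htop
  have hle : Filter.limsup (fun t => (κ t ω : ℝ≥0∞)) atTop ≤ r :=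
    limsup_le_of_le (h := Eventually.of_forall fun t => by
      have : (t : ℝ≥0∞) < rhoZero κ r ω := by simp [htop]
      exact_mod_cast ((lt_rhoZero_iff (hcont ω) t).1 this t le_rfl).le)
  simp [hω] at hle

/-- `κ ^ p` at time `N ∧ λ_ℓ ∧ ρ_R` is at most `ℓ ^ p`, except on `{ρ_R < λ_ℓ}` and on `{N < ρ_R}`,
where it is at most `R ^ p`. -/
theorem rpow_stopped_le {p : ℝ} (hp : 0 < p) {ℓ R N : ℝ≥0} {ω : Ω}
    (hc : Continuous fun t => κ t ω) (h0 : 0 < rhoZero κ R ω) :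
    (κ ((min (N : ℝ≥0∞) (min (lamZero κ ℓ ω) (rhoZero κ R ω))).toNNReal) ω : ℝ) ^ p ≤
      (ℓ : ℝ) ^ p + {ω | rhoZero κ R ω < lamZero κ ℓ ω}.indicator (fun _ => (R : ℝ) ^ p) ω
        + {ω | (N : ℝ≥0∞) < rhoZero κ R ω}.indicator (fun _ => (R : ℝ) ^ p) ω := by
  have hℓ : 0 ≤ (ℓ : ℝ) ^ p := by positivity
  have hi : ∀ s : Set Ω, 0 ≤ s.indicator (fun _ => (R : ℝ) ^ p) ω := fun s =>
    indicator_nonneg (fun _ _ => by positivity) _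
  have hmono : ∀ {x y : ℝ≥0}, x ≤ y → (x : ℝ) ^ p ≤ (y : ℝ) ^ p := fun hxy =>
    Real.rpow_le_rpow (NNReal.coe_nonneg _) (NNReal.coe_le_coe.2 hxy) hp.le
  have hR : ∀ a : ℝ≥0, (a : ℝ≥0∞) ≤ rhoZero κ R ω → κ a ω ≤ R := by
    intro a ha
    have hlt : ∀ s, s < a → κ s ω < R := fun s hs =>
      (lt_rhoZero_iff hc s).1 ((ENNReal.coe_lt_coe.2 hs).trans_le ha) s le_rfl
    rcases eq_zero_or_pos a with rfl | hpos
    · exact ((lt_rhoZero_iff hc 0).1 (by simpa using h0) 0 le_rfl).le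
    · exact le_of_forall_lt_le hc hpos fun s _ hs => (hlt s hs).le
  by_cases hlt : rhoZero κ R ω < lamZero κ ℓ ω
  · have hR' := hR (min (N : ℝ≥0∞) (min (lamZero κ ℓ ω) (rhoZero κ R ω))).toNNReal (by
      rw [ENNReal.coe_toNNReal (ne_top_of_le_ne_top ENNReal.coe_ne_top (min_le_left _ _))]
      exact (min_le_right _ _).trans (min_le_right _ _))
    rw [indicator_of_mem (s := {ω | rhoZero κ R ω < lamZero κ ℓ ω}) hlt]
    linarith [hmono hR', hi {ω | (N : ℝ≥0∞) < rhoZero κ R ω}]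
  · rw [min_eq_left (not_lt.1 hlt)]
    by_cases hN : (N : ℝ≥0∞) < lamZero κ ℓ ω
    · have hN' : (N : ℝ≥0∞) < rhoZero κ R ω := hN.trans_le (not_lt.1 hlt)
      rw [min_eq_left hN.le, ENNReal.toNNReal_coe,
        indicator_of_mem (s := {ω | (N : ℝ≥0∞) < rhoZero κ R ω}) hN']
      linarith [hmono (hR N hN'.le), hi {ω | rhoZero κ R ω < lamZero κ ℓ ω}]
    · rw [min_eq_right (not_lt.1 hN)]
      have hne : lamZero κ ℓ ω ≠ ⊤ := ne_top_of_le_ne_top ENNReal.coe_ne_top (not_lt.1 hN)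
      have := le_of_lamZero_eq hc (ENNReal.coe_toNNReal hne).symm
      linarith [hmono this, hi {ω | rhoZero κ R ω < lamZero κ ℓ ω},
        hi {ω | (N : ℝ≥0∞) < rhoZero κ R ω}]

section Submartingale

variable {μ : Measure Ω} {p : ℝ} {ℓ R t : ℝ≥0} {B : Set Ω}

theorem eqOn_stopped (hBt : ∀ ω ∈ B, (t : ℝ≥0∞) < lamZero κ ℓ ω ∧ (t : ℝ≥0∞) < rhoZero κ R ω) :
    EqOn (fun ω => (κ ((min (t : ℝ≥0∞) (min (lamZero κ ℓ ω) (rhoZero κ R ω))).toNNReal) ω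
      : ℝ) ^ p) (fun ω => (κ t ω : ℝ) ^ p) B := fun ω hω => by
  have h : min (t : ℝ≥0∞) (min (lamZero κ ℓ ω) (rhoZero κ R ω)) = t :=
    min_eq_left (le_min (hBt ω hω).1.le (hBt ω hω).2.le)
  simp only [h, ENNReal.toNNReal_coe]

theorem integrableOn_rpow_sub [IsFiniteMeasure μ]
    (hsub : Submartingale
        (fun (t : ℝ≥0) ω =>
          (κ ((min ((t : ℝ≥0) : ℝ≥0∞) (min (lamZero κ ℓ ω) (rhoZero κ R ω))).toNNReal) ω
            : ℝ) ^ p) ℱ μ)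
    (hB : MeasurableSet[ℱ t] B)
    (hBt : ∀ ω ∈ B, (t : ℝ≥0∞) < lamZero κ ℓ ω ∧ (t : ℝ≥0∞) < rhoZero κ R ω) :
    IntegrableOn (fun ω => (κ t ω : ℝ) ^ p - (ℓ : ℝ) ^ p) B μ :=
  ((hsub.integrable t).integrableOn.congr_fun (eqOn_stopped hBt) (ℱ.le t _ hB)).sub
    (integrable_const _)

/-- On an event of `F_t` contained in `{t < λ_ℓ ∧ ρ_R}`, the probability of reaching `R` before
`ℓ` is bounded below through the submartingale `κ ^ p`. -/
theorem setIntegral_rpow_sub_le [IsFiniteMeasure μ] (hp : 0 < p)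
    (hadapt : ∀ t : ℝ≥0, Measurable[ℱ t] (κ t)) (hcont : ∀ ω, Continuous fun t => κ t ω)
    (hfin : ∀ᵐ ω ∂μ, rhoZero κ R ω ≠ ⊤)
    (hsub : Submartingale
        (fun (t : ℝ≥0) ω =>
          (κ ((min ((t : ℝ≥0) : ℝ≥0∞) (min (lamZero κ ℓ ω) (rhoZero κ R ω))).toNNReal) ω
            : ℝ) ^ p) ℱ μ)
    (hB : MeasurableSet[ℱ t] B)
    (hBt : ∀ ω ∈ B, (t : ℝ≥0∞) < lamZero κ ℓ ω ∧ (t : ℝ≥0∞) < rhoZero κ R ω) :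
    ∫ ω in B, ((κ t ω : ℝ) ^ p - (ℓ : ℝ) ^ p) ∂μ ≤
      (R : ℝ) ^ p * μ.real (B ∩ {ω | rhoZero κ R ω < lamZero κ ℓ ω}) := by
  have hBm := ℱ.le t _ hB
  have hρ := measurable_rhoZero hadapt hcont R
  have hlam := measurable_lamZero hadapt hcont ℓ
  have hm1 : MeasurableSet {ω | rhoZero κ R ω < lamZero κ ℓ ω} := measurableSet_lt hρ hlam
  have hm2 : ∀ N : ℝ≥0, MeasurableSet {ω | (N : ℝ≥0∞) < rhoZero κ R ω} := fun N =>
    measurableSet_lt measurable_const hρ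
  have hkey : ∀ n : ℕ, ∫ ω in B, ((κ t ω : ℝ) ^ p - (ℓ : ℝ) ^ p) ∂μ ≤
      (R : ℝ) ^ p * μ.real (B ∩ {ω | rhoZero κ R ω < lamZero κ ℓ ω}) +
        (R : ℝ) ^ p * μ.real {ω | ((n : ℝ≥0) : ℝ≥0∞) < rhoZero κ R ω} := by
    intro n
    have hle : t ≤ t + n := le_self_add
    have h1 := hsub.setIntegral_le hle hB
    rw [setIntegral_congr_fun hBm (eqOn_stopped hBt)] at h1
    have hint1 : IntegrableOn ({ω | rhoZero κ R ω < lamZero κ ℓ ω}.indicator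
        (fun _ => (R : ℝ) ^ p)) B μ := ((integrable_const _).indicator hm1).integrableOn
    have hint2 : IntegrableOn ({ω | ((t + n : ℝ≥0) : ℝ≥0∞) < rhoZero κ R ω}.indicator
        (fun _ => (R : ℝ) ^ p)) B μ := ((integrable_const _).indicator (hm2 _)).integrableOn
    have hint0 : IntegrableOn (fun _ : Ω => (ℓ : ℝ) ^ p) B μ := (integrable_const _)
    have h2 := setIntegral_mono_on (hsub.integrable (t + n)).integrableOn
      ((hint0.add hint1).add hint2) hBm fun ω hω =>
        rpow_stopped_le (ℓ := ℓ) (N := t + n) hp (hcont ω)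
        (pos_of_gt (hBt ω hω).2)
    have h3 : ∫ ω in B, ((ℓ : ℝ) ^ p + {ω | rhoZero κ R ω < lamZero κ ℓ ω}.indicator
          (fun _ => (R : ℝ) ^ p) ω + {ω | ((t + n : ℝ≥0) : ℝ≥0∞) < rhoZero κ R ω}.indicator
        (fun _ => (R : ℝ) ^ p) ω) ∂μ = ∫ ω in B, (ℓ : ℝ) ^ p ∂μ
          + (R : ℝ) ^ p * μ.real (B ∩ {ω | rhoZero κ R ω < lamZero κ ℓ ω})
          + (R : ℝ) ^ p * μ.real (B ∩ {ω | ((t + n : ℝ≥0) : ℝ≥0∞) < rhoZero κ R ω}) := by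
      refine (integral_add' (hint0.add hint1) hint2).trans ?_
      rw [integral_add' hint0 hint1, setIntegral_indicator hm1, setIntegral_indicator (hm2 _),
        setIntegral_const, setIntegral_const, setIntegral_const, smul_eq_mul, smul_eq_mul,
        smul_eq_mul, mul_comm ((R : ℝ) ^ p), mul_comm ((R : ℝ) ^ p)]
    have h4 : μ.real (B ∩ {ω | ((t + n : ℝ≥0) : ℝ≥0∞) < rhoZero κ R ω}) ≤
        μ.real {ω | ((n : ℝ≥0) : ℝ≥0∞) < rhoZero κ R ω} := by
      refine measureReal_mono fun ω hω => ?_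
      exact lt_of_le_of_lt (ENNReal.coe_le_coe.2 le_add_self) hω.2
    have h5 := mul_le_mul_of_nonneg_left h4 (by positivity : 0 ≤ (R : ℝ) ^ p)
    rw [integral_sub ((hsub.integrable t).integrableOn.congr_fun (eqOn_stopped hBt) hBm) hint0]
    simp only [Pi.add_apply] at h2
    linarith
  have hlim : Tendsto (fun n : ℕ => μ.real {ω | ((n : ℝ≥0) : ℝ≥0∞) < rhoZero κ R ω}) atTop
      (nhds 0) := by
    have h1 := tendsto_measure_iInter_atTop (μ := μ)
      (s := fun n : ℕ => {ω | ((n : ℝ≥0) : ℝ≥0∞) < rhoZero κ R ω})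
      (fun n => (hm2 _).nullMeasurableSet)
      (fun m n hmn ω (hω : ((n : ℝ≥0) : ℝ≥0∞) < rhoZero κ R ω) =>
        lt_of_le_of_lt (ENNReal.coe_le_coe.2 (Nat.cast_le.2 hmn)) hω) ⟨0, measure_ne_top _ _⟩
    have h2 : μ (⋂ n : ℕ, {ω | ((n : ℝ≥0) : ℝ≥0∞) < rhoZero κ R ω}) = 0 := by
      refine measure_mono_null (fun ω hω => ?_) (ae_iff.1 hfin)
      simp only [mem_iInter, mem_ofPred_eq] at hω
      simp only [mem_ofPred_eq, not_not]
      by_contra hne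
      obtain ⟨n, hn⟩ := ENNReal.exists_nat_gt hne
      exact absurd (hω n) (not_lt.2 (by simpa using hn.le))
    rw [h2] at h1
    rw [← ENNReal.toReal_zero]
    exact (ENNReal.tendsto_toReal ENNReal.zero_ne_top).comp h1
  have hlim' := (hlim.const_mul ((R : ℝ) ^ p)).const_add
    ((R : ℝ) ^ p * μ.real (B ∩ {ω | rhoZero κ R ω < lamZero κ ℓ ω}))
  rw [mul_zero, add_zero] at hlim'
  exact ge_of_tendsto' hlim' hkey

/-- An event of `F_t` contained in `{t < λ_ℓ ∧ ρ_R}` on which `R` is almost surely not reached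
before `ℓ` is null. -/
theorem measure_eq_zero_of_inter_eq_zero [IsFiniteMeasure μ] (hp : 0 < p)
    (hadapt : ∀ t : ℝ≥0, Measurable[ℱ t] (κ t)) (hcont : ∀ ω, Continuous fun t => κ t ω)
    (hfin : ∀ᵐ ω ∂μ, rhoZero κ R ω ≠ ⊤)
    (hsub : Submartingale
        (fun (t : ℝ≥0) ω =>
          (κ ((min ((t : ℝ≥0) : ℝ≥0∞) (min (lamZero κ ℓ ω) (rhoZero κ R ω))).toNNReal) ω
            : ℝ) ^ p) ℱ μ)
    (hB : MeasurableSet[ℱ t] B)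
    (hBt : ∀ ω ∈ B, (t : ℝ≥0∞) < lamZero κ ℓ ω ∧ (t : ℝ≥0∞) < rhoZero κ R ω)
    (h0 : μ (B ∩ {ω | rhoZero κ R ω < lamZero κ ℓ ω}) = 0) : μ B = 0 := by
  have hle := setIntegral_rpow_sub_le hp hadapt hcont hfin hsub hB hBt
  rw [measureReal_def, h0, ENNReal.toReal_zero, mul_zero] at hle
  have hpos : ∀ ω ∈ B, 0 < (κ t ω : ℝ) ^ p - (ℓ : ℝ) ^ p := fun ω hω =>
    sub_pos.2 (Real.rpow_lt_rpow (NNReal.coe_nonneg _)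
      (NNReal.coe_lt_coe.2 ((lt_lamZero_iff (hcont ω) t).1 (hBt ω hω).1 t le_rfl)) hp)
  have hBm := ℱ.le t _ hB
  by_contra hne
  refine absurd hle (not_le.2 ((setIntegral_pos_iff_support_of_nonneg_ae ?_
    (integrableOn_rpow_sub hsub hB hBt)).2 ?_))
  · exact (ae_restrict_iff' hBm).2 (Eventually.of_forall fun ω hω => (hpos ω hω).le)
  · exact (pos_iff_ne_zero.2 hne).trans_le
      (measure_mono fun ω hω => ⟨(hpos ω hω).ne', hω⟩)

/-- On `{ℓ < κ₀}`, a lower bound for the probability of reaching `R` before `ℓ`. -/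
theorem setIntegral_min_le [IsFiniteMeasure μ] (hp : 0 < p) (hℓR : ℓ < R)
    (hadapt : ∀ t : ℝ≥0, Measurable[ℱ t] (κ t)) (hcont : ∀ ω, Continuous fun t => κ t ω)
    (hfin : ∀ᵐ ω ∂μ, rhoZero κ R ω ≠ ⊤)
    (hsub : Submartingale
        (fun (t : ℝ≥0) ω =>
          (κ ((min ((t : ℝ≥0) : ℝ≥0∞) (min (lamZero κ ℓ ω) (rhoZero κ R ω))).toNNReal) ω
            : ℝ) ^ p) ℱ μ)
    (hB : MeasurableSet[ℱ 0] B) (hBℓ : ∀ ω ∈ B, ℓ < κ 0 ω) :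
    ∫ ω in B, min (((κ 0 ω : ℝ) ^ p - (ℓ : ℝ) ^ p) * ((R : ℝ) ^ p)⁻¹) 1 ∂μ ≤
      μ.real (B ∩ {ω | rhoZero κ R ω < lamZero κ ℓ ω}) := by
  have hRp : 0 < (R : ℝ) ^ p := Real.rpow_pos_of_pos (NNReal.coe_pos.2 (pos_of_gt hℓR)) _
  have hBm := ℱ.le 0 _ hB
  have hκ : Measurable (κ 0) := (hadapt 0).mono (ℱ.le 0) le_rfl
  set S : Set Ω := {ω | rhoZero κ R ω < lamZero κ ℓ ω} with hS
  have hSm : MeasurableSet S := measurableSet_lt (measurable_rhoZero hadapt hcont R)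
    (measurable_lamZero hadapt hcont ℓ)
  set B₁ : Set Ω := B ∩ {ω | ((0 : ℝ≥0) : ℝ≥0∞) < rhoZero κ R ω} with hB₁
  have hB₁m : MeasurableSet[ℱ 0] B₁ := hB.inter (measurableSet_lt_rhoZero hadapt hcont R 0)
  have hlt : ∀ ω ∈ B, ((0 : ℝ≥0) : ℝ≥0∞) < lamZero κ ℓ ω := fun ω hω =>
    (lt_lamZero_iff (hcont ω) 0).2 fun s hs => by
      rw [nonpos_iff_eq_zero.1 hs]; exact hBℓ ω hω
  have hBt : ∀ ω ∈ B₁, ((0 : ℝ≥0) : ℝ≥0∞) < lamZero κ ℓ ω ∧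
      ((0 : ℝ≥0) : ℝ≥0∞) < rhoZero κ R ω := fun ω hω => ⟨hlt ω hω.1, hω.2⟩
  have h1 := setIntegral_rpow_sub_le hp hadapt hcont hfin hsub hB₁m hBt
  have hi1 := integrableOn_rpow_sub hsub hB₁m hBt
  have hint : IntegrableOn
      (fun ω => min (((κ 0 ω : ℝ) ^ p - (ℓ : ℝ) ^ p) * ((R : ℝ) ^ p)⁻¹) 1) B μ := by
    refine Measure.integrableOn_of_bounded (M := 1) (measure_ne_top _ _)
      ((((hκ.coe_nnreal_real.pow_const p).sub_const _).mul_const _).min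
        measurable_const).aestronglyMeasurable ?_
    refine (ae_restrict_iff' hBm).2 (Eventually.of_forall fun ω hω => ?_)
    have h0 : 0 ≤ (κ 0 ω : ℝ) ^ p - (ℓ : ℝ) ^ p := sub_nonneg.2
      (Real.rpow_le_rpow (NNReal.coe_nonneg _) (NNReal.coe_le_coe.2 (hBℓ ω hω).le) hp.le)
    rw [Real.norm_of_nonneg (le_min (by positivity) zero_le_one)]
    exact min_le_right _ _
  have hdiff : MeasurableSet (B \ B₁) := hBm.diff (ℱ.le 0 _ hB₁m)
  have hB₁B : B₁ ⊆ B := inter_subset_left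
  rw [← integral_inter_add_sdiff (ℱ.le 0 _ hB₁m) hint, inter_eq_self_of_subset_right hB₁B]
  have h2 : ∫ ω in B₁, min (((κ 0 ω : ℝ) ^ p - (ℓ : ℝ) ^ p) * ((R : ℝ) ^ p)⁻¹) 1 ∂μ ≤
      μ.real (B₁ ∩ S) := by
    calc _ ≤ ∫ ω in B₁, ((κ 0 ω : ℝ) ^ p - (ℓ : ℝ) ^ p) * ((R : ℝ) ^ p)⁻¹ ∂μ :=
          setIntegral_mono (hint.mono_set hB₁B) (hi1.mul_const _) fun ω => min_le_left _ _
      _ = (∫ ω in B₁, ((κ 0 ω : ℝ) ^ p - (ℓ : ℝ) ^ p) ∂μ) * ((R : ℝ) ^ p)⁻¹ :=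
          integral_mul_const _ _
      _ ≤ μ.real (B₁ ∩ S) := by
          rw [← div_eq_mul_inv, div_le_iff₀ hRp, mul_comm]; exact h1
  have h3 : ∫ ω in B \ B₁, min (((κ 0 ω : ℝ) ^ p - (ℓ : ℝ) ^ p) * ((R : ℝ) ^ p)⁻¹) 1 ∂μ ≤
      μ.real ((B \ B₁) ∩ S) := by
    have hsubS : B \ B₁ ⊆ S := fun ω hω => by
      have h0 : rhoZero κ R ω ≤ ((0 : ℝ≥0) : ℝ≥0∞) := not_lt.1 fun h => hω.2 ⟨hω.1, h⟩
      exact h0.trans_lt (hlt ω hω.1)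
    rw [inter_eq_self_of_subset_left hsubS]
    calc _ ≤ ∫ ω in B \ B₁, (1 : ℝ) ∂μ :=
          setIntegral_mono (hint.mono_set sdiff_subset) (integrable_const _)
            fun ω => min_le_right _ _
      _ = μ.real (B \ B₁) := by simp
  have h4 : μ.real (B ∩ S) = μ.real (B₁ ∩ S) + μ.real ((B \ B₁) ∩ S) := by
    rw [← measureReal_union (disjoint_sdiff_right.mono inter_subset_left inter_subset_left)
      (hdiff.inter hSm), ← union_inter_distrib_right, union_sdiff_cancel hB₁B]
  linarith

end Submartingale

section Excursion

variable {C r q a : ℝ≥0} {ω : Ω}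

theorem lt_div_one_sub (hr : 0 < r) (hq : 0 < q) (hq1 : q < 1) : r < r / (1 - q) := by
  rw [lt_div_iff₀ (tsub_pos_of_lt hq1)]
  exact mul_lt_of_lt_one_right hr (tsub_lt_self one_pos hq)

theorem le_of_le_lamAfterRho (hc : Continuous fun t => κ t ω) (hr : 0 < r) (hq : 0 < q)
    (hq1 : q < 1) (ha : rhoRq κ r q ω = a) {s : ℝ≥0}
    (hs : ((a + s : ℝ≥0) : ℝ≥0∞) ≤ lamAfterRho κ r q ω) : r ≤ κ (a + s) ω := by
  rcases eq_zero_or_pos s with rfl | hpos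
  · rw [add_zero]
    exact (lt_div_one_sub hr hq hq1).le.trans (le_of_rhoZero_eq hc ha)
  · refine ge_of_forall_lt_ge hc (a := a) (lt_add_of_pos_right a hpos) fun u hau hus => ?_
    obtain ⟨v, rfl⟩ := exists_add_of_le hau
    exact ((add_lt_hitBelow_iff hc ha v).1 ((ENNReal.coe_lt_coe.2 hus).trans_le hs) v le_rfl).le

theorem exists_min_eq (ha : rhoRq κ r q ω = a) (t : ℝ≥0) :
    ∃ s ≤ t, min (rhoRq κ r q ω + (t : ℝ≥0∞)) (lamAfterRho κ r q ω) = (a + s : ℝ≥0) := by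
  have hle : (a : ℝ≥0∞) ≤ lamAfterRho κ r q ω := by
    rw [← ha]; exact le_self_add
  rw [ha, ← ENNReal.coe_add]
  rcases le_total ((a + t : ℝ≥0) : ℝ≥0∞) (lamAfterRho κ r q ω) with h | h
  · exact ⟨t, le_rfl, min_eq_left h⟩
  · obtain ⟨b, hb⟩ : ∃ b : ℝ≥0, (b : ℝ≥0∞) = lamAfterRho κ r q ω :=
      ⟨_, ENNReal.coe_toNNReal (ne_top_of_le_ne_top ENNReal.coe_ne_top h)⟩
    rw [← hb] at h hle ⊢
    obtain ⟨s, rfl⟩ := exists_add_of_le (ENNReal.coe_le_coe.1 hle)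
    exact ⟨s, by simpa using ENNReal.coe_le_coe.1 h, min_eq_right h⟩

theorem continuousOn_inv_pow (hc : Continuous fun t => κ t ω) {s : ℝ≥0}
    (hpos : ∀ u ≤ s, 0 < κ (a + u) ω) :
    ContinuousOn (fun u : ℝ => ((κ u.toNNReal ω : ℝ) ^ 4)⁻¹) (Icc (a : ℝ) ((a + s : ℝ≥0) : ℝ)) := by
  refine ContinuousOn.inv₀ (by fun_prop) fun u hu => ?_
  obtain ⟨v, rfl⟩ : ∃ v : ℝ≥0, u = v := ⟨⟨u, a.2.trans hu.1⟩, rfl⟩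
  obtain ⟨w, rfl⟩ := exists_add_of_le (NNReal.coe_le_coe.1 hu.1)
  have hw : w ≤ s := by simpa using NNReal.coe_le_coe.1 hu.2
  have := hpos w hw
  rw [Real.toNNReal_coe]
  positivity

theorem excursionProc_zero_le (hc : Continuous fun t => κ t ω) (hr : 0 < r) (hq1 : q < 1)
    (ha : rhoRq κ r q ω = a) :
    excursionProc κ C r q 0 ω ≤ (((r / (1 - q) : ℝ≥0) : ℝ) ^ 2)⁻¹ := by
  obtain ⟨s, hs, h⟩ := exists_min_eq (κ := κ) ha 0
  obtain rfl : s = 0 := nonpos_iff_eq_zero.1 hs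
  have hR : 0 < r / (1 - q) := div_pos hr (tsub_pos_of_lt hq1)
  have hκ : r / (1 - q) ≤ κ a ω := le_of_rhoZero_eq hc ha
  rw [excursionProc, h, ha]
  simp only [add_zero, ENNReal.toNNReal_coe, Ioc_self, Measure.restrict_empty,
    integral_zero_measure, mul_zero, sub_zero]
  exact inv_anti₀ (by positivity) (by gcongr)

/-- Before time `t`, the excursion above `r` costs at most `C t r⁻⁴`, and it has value `r⁻²`
once it is over. -/
theorem le_excursionProc (hc : Continuous fun t => κ t ω) (hr : 0 < r) (hq : 0 < q)
    (hq1 : q < 1) (ha : rhoRq κ r q ω = a) (t : ℝ≥0) :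
    {ω | lamAfterRho κ r q ω < rhoRq κ r q ω + t}.indicator (fun _ => ((r : ℝ) ^ 2)⁻¹) ω
      - (C : ℝ) * (t * ((r : ℝ) ^ 4)⁻¹) ≤ excursionProc κ C r q t ω := by
  obtain ⟨s, hst, h⟩ := exists_min_eq (κ := κ) ha t
  have hle : ∀ u ≤ s, r ≤ κ (a + u) ω := fun u hu =>
    le_of_le_lamAfterRho hc hr hq hq1 ha
      ((ENNReal.coe_le_coe.2 (by gcongr)).trans (h.ge.trans (min_le_right _ _)))
  rw [excursionProc, h, ha]
  simp only [ENNReal.toNNReal_coe]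
  have hint : ∫ u in Ioc (a : ℝ) ((a + s : ℝ≥0) : ℝ), ((κ u.toNNReal ω : ℝ) ^ 4)⁻¹ ≤
      t * ((r : ℝ) ^ 4)⁻¹ := by
    have hbound := norm_setIntegral_le_of_norm_le_const (μ := volume)
      (s := Ioc (a : ℝ) ((a + s : ℝ≥0) : ℝ)) (C := ((r : ℝ) ^ 4)⁻¹)
      (f := fun u : ℝ => ((κ u.toNNReal ω : ℝ) ^ 4)⁻¹) measure_Ioc_lt_top fun u hu => by
        obtain ⟨v, rfl⟩ : ∃ v : ℝ≥0, u = v := ⟨⟨u, a.2.trans hu.1.le⟩, rfl⟩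
        obtain ⟨w, rfl⟩ := exists_add_of_le (NNReal.coe_le_coe.1 hu.1.le)
        have hw : w ≤ s := by simpa using NNReal.coe_le_coe.1 hu.2
        have := hle w hw
        rw [Real.toNNReal_coe, Real.norm_of_nonneg (by positivity)]
        exact inv_anti₀ (by positivity) (by gcongr)
    refine (Real.le_norm_self _).trans (hbound.trans ?_)
    rw [Real.volume_real_Ioc_of_le (by simp), mul_comm]
    have : (s : ℝ) ≤ t := hst
    gcongr
    simpa using this
  have hval : {ω | lamAfterRho κ r q ω < rhoRq κ r q ω + t}.indicator
      (fun _ => ((r : ℝ) ^ 2)⁻¹) ω ≤ ((κ (a + s) ω : ℝ) ^ 2)⁻¹ := by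
    by_cases hlt : lamAfterRho κ r q ω < rhoRq κ r q ω + t
    · have hle' : κ (a + s) ω ≤ r := le_of_hitBelow_eq hc ha ((min_eq_right hlt.le).symm.trans h)
      have hpos := hr.trans_le (hle s le_rfl)
      rw [indicator_of_mem (s := {ω | lamAfterRho κ r q ω < rhoRq κ r q ω + t}) hlt]
      exact inv_anti₀ (by positivity) (by gcongr)
    · rw [indicator_of_notMem (s := {ω | lamAfterRho κ r q ω < rhoRq κ r q ω + t}) hlt]
      positivity
  have := mul_le_mul_of_nonneg_left hint C.2
  simp only [NNReal.val_eq_coe] at this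
  linarith

theorem excursionProc_le (hc : Continuous fun t => κ t ω) (hr : 0 < r)
    (ha : rhoRq κ r q ω = a) {s b K : ℝ≥0}
    (hs : ((a + s : ℝ≥0) : ℝ≥0∞) < lamAfterRho κ r q ω) (hab : a ≤ b) (hbs : b ≤ a + s)
    (hK : ∀ u ≤ b, κ u ω ≤ K) :
    excursionProc κ C r q s ω ≤
      ((κ (a + s) ω : ℝ) ^ 2)⁻¹ - (C : ℝ) * (((K : ℝ) ^ 4)⁻¹ * (b - a)) := by
  have hlt := (add_lt_hitBelow_iff hc ha s).1 hs
  have hmin : min (rhoRq κ r q ω + (s : ℝ≥0∞)) (lamAfterRho κ r q ω) = (a + s : ℝ≥0) := by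
    rw [ha, ← ENNReal.coe_add]; exact min_eq_left hs.le
  have hcont := continuousOn_inv_pow hc fun u hu => hr.trans (hlt u hu)
  rw [excursionProc, hmin, ha]
  simp only [ENNReal.toNNReal_coe]
  gcongr
  have hint : IntegrableOn (fun u : ℝ => ((κ u.toNNReal ω : ℝ) ^ 4)⁻¹)
      (Ioc (a : ℝ) ((a + s : ℝ≥0) : ℝ)) :=
    hcont.integrableOn_Icc.mono_set Ioc_subset_Icc_self
  have hsub : Ioc (a : ℝ) b ⊆ Ioc (a : ℝ) ((a + s : ℝ≥0) : ℝ) :=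
    Ioc_subset_Ioc_right (NNReal.coe_le_coe.2 hbs)
  calc ((K : ℝ) ^ 4)⁻¹ * (b - a) = ((K : ℝ) ^ 4)⁻¹ * volume.real (Ioc (a : ℝ) b) := by
        rw [Real.volume_real_Ioc_of_le (NNReal.coe_le_coe.2 hab)]
    _ ≤ ∫ u in Ioc (a : ℝ) b, ((κ u.toNNReal ω : ℝ) ^ 4)⁻¹ := by
        refine setIntegral_ge_of_const_le_real measurableSet_Ioc measure_Ioc_lt_top.ne
          (fun u hu => ?_) (hint.mono_set hsub)
        obtain ⟨v, rfl⟩ : ∃ v : ℝ≥0, u = v := ⟨⟨u, a.2.trans hu.1.le⟩, rfl⟩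
        have hvb : v ≤ b := NNReal.coe_le_coe.1 hu.2
        obtain ⟨w, rfl⟩ := exists_add_of_le (NNReal.coe_le_coe.1 hu.1.le)
        have hw : w ≤ s := by simpa using hvb.trans hbs
        have h1 := hr.trans (hlt w hw)
        have h2 := hK _ hvb
        rw [Real.toNNReal_coe]
        exact inv_anti₀ (by positivity) (by gcongr)
    _ ≤ _ := setIntegral_mono_set hint (Eventually.of_forall fun u => by positivity)
        hsub.eventuallyLE

/-- An excursion above `r` of length `t` started before `λ_ℓ` contributes at least `t h(r)` to
the additive functional. -/
theorem mul_le_addFunToLam (hc : Continuous fun t => κ t ω) {h : ℝ≥0 → ℝ≥0} (hmono : Monotone h)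
    {ℓ t : ℝ≥0} (hℓr : ℓ < r) (ha : rhoRq κ r q ω = a) (hρ : rhoRq κ r q ω < lamZero κ ℓ ω)
    (ht : rhoRq κ r q ω + t ≤ lamAfterRho κ r q ω) :
    ((t * h r : ℝ≥0) : ℝ≥0∞) ≤ addFunToLam κ h ℓ ω := by
  rw [ha] at hρ ht
  have hlt : ∀ u < t, r < κ (a + u) ω := fun u hu =>
    (add_lt_hitBelow_iff hc ha u).1 (lt_of_lt_of_le (by
      rw [← ENNReal.coe_add]; exact ENNReal.coe_lt_coe.2 (by gcongr)) ht) u le_rfl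
  have hlam : ∀ u < t, ((a + u : ℝ≥0) : ℝ≥0∞) < lamZero κ ℓ ω := fun u hu => by
    rw [lt_lamZero_iff hc]
    intro s hs
    rcases le_total s a with h | h
    · exact (lt_lamZero_iff hc a).1 hρ s h
    · obtain ⟨v, rfl⟩ := exists_add_of_le h
      exact hℓr.trans (hlt v (lt_of_le_of_lt (by simpa using hs) hu))
  calc ((t * h r : ℝ≥0) : ℝ≥0∞) = ∫⁻ _ in Ico (a : ℝ) (a + t), (h r : ℝ≥0∞) := by
        rw [setLIntegral_const, Real.volume_Ico, add_sub_cancel_left, ENNReal.ofReal_coe_nnreal,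
          ENNReal.coe_mul, mul_comm]
    _ ≤ ∫⁻ u in Ico (a : ℝ) (a + t), (h (κ u.toNNReal ω) : ℝ≥0∞) := by
        refine setLIntegral_mono' measurableSet_Ico fun u hu => ?_
        obtain ⟨v, rfl⟩ : ∃ v : ℝ≥0, u = v := ⟨⟨u, a.2.trans hu.1⟩, rfl⟩
        obtain ⟨w, rfl⟩ := exists_add_of_le (NNReal.coe_le_coe.1 hu.1)
        have hw : w < t := by simpa using hu.2
        rw [Real.toNNReal_coe]
        exact ENNReal.coe_le_coe.2 (hmono (hlt w hw).le)
    _ ≤ addFunToLam κ h ℓ ω := by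
        refine lintegral_mono_set fun u hu => ?_
        obtain ⟨v, rfl⟩ : ∃ v : ℝ≥0, u = v := ⟨⟨u, a.2.trans hu.1⟩, rfl⟩
        obtain ⟨w, rfl⟩ := exists_add_of_le (NNReal.coe_le_coe.1 hu.1)
        have hw : w < t := by simpa using hu.2
        refine ⟨NNReal.coe_nonneg _, ?_⟩
        rw [ENNReal.ofReal_coe_nnreal]
        exact (hlam w hw).le

end Excursion

theorem measurable_hitBelow (hadapt : ∀ t : ℝ≥0, Measurable[ℱ t] (κ t))
    (hcont : ∀ ω, Continuous fun t => κ t ω) (ℓ : ℝ≥0) {T : Ω → ℝ≥0∞} (hT : Measurable T) :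
    Measurable (hitBelow κ ℓ T) := by
  refine hT.add (measurable_of_measurableSet_coe_lt fun t => ?_)
  have hpos := measurableSet_forall_le_pos (t := t)
    (f := fun s ω => (κ ((T ω).toNNReal + s) ω : ℝ) - ℓ)
    (fun s _ => ((measurable_uncurry_path hadapt hcont).comp
      (f := fun ω => ((T ω).toNNReal + s, ω))
      ((hT.ennreal_toNNReal.add_const s).prodMk measurable_id)).coe_nnreal_real.sub_const _)
    (fun ω => by have := hcont ω; fun_prop)
  convert (hT (measurableSet_singleton ⊤)).union hpos using 1
  ext ω
  by_cases htop : T ω = ⊤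
  · simp [htop]
  · have hcl : IsClosed {u : ℝ≥0 | κ ((T ω).toNNReal + u) ω ≤ ℓ} :=
      isClosed_le ((hcont ω).comp (continuous_const.add continuous_id)) continuous_const
    simpa [htop] using coe_lt_sInf_image_coe_iff hcl t

section Supermartingale

variable {μ : Measure Ω} {C r q : ℝ≥0}

/-- Conditionally on `F_ρ`, the excursion above `r` lasts at least `t` with probability at
least `q`. -/
theorem mul_measureReal_le_of_stoppedSigma_le [IsFiniteMeasure μ]
    (hadapt : ∀ t : ℝ≥0, Measurable[ℱ t] (κ t)) (hcont : ∀ ω, Continuous fun t => κ t ω)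
    (hr : 0 < r) (hq : 0 < q) (hq1 : q < 1)
    (hle : stoppedSigma ℱ (rhoRq κ r q) ≤ m0)
    (hint : ∀ t : ℝ≥0, Integrable (excursionProc κ C r q t) μ) {t : ℝ≥0}
    (hsup : μ[excursionProc κ C r q t | stoppedSigma ℱ (rhoRq κ r q)]
      ≤ᵐ[μ] excursionProc κ C r q 0)
    {A : Set Ω} (hA : MeasurableSet[stoppedSigma ℱ (rhoRq κ r q)] A)
    (hAfin : ∀ ω ∈ A, rhoRq κ r q ω ≠ ⊤) (ht : C * t ≤ q * (1 - q) * r ^ 2) :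
    (q : ℝ) * μ.real A ≤
      μ.real (A ∩ {ω | rhoRq κ r q ω + t ≤ lamAfterRho κ r q ω}) := by
  have hAm := hle _ hA
  have hρ : Measurable (rhoRq κ r q) := measurable_rhoZero hadapt hcont (r / (1 - q))
  have hlam : Measurable (lamAfterRho κ r q) := measurable_hitBelow hadapt hcont r hρ
  set D : Set Ω := {ω | lamAfterRho κ r q ω < rhoRq κ r q ω + t} with hD
  have hDm : MeasurableSet D := measurableSet_lt hlam (hρ.add_const _)
  have h1 : ∫ ω in A, excursionProc κ C r q t ω ∂μ ≤ ∫ ω in A, excursionProc κ C r q 0 ω ∂μ := by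
    rw [← setIntegral_condExp hle (hint t) hA]
    exact setIntegral_mono_ae integrable_condExp.integrableOn (hint 0).integrableOn hsup
  have h2 : ∫ ω in A, excursionProc κ C r q 0 ω ∂μ ≤
      ∫ ω in A, (((r / (1 - q) : ℝ≥0) : ℝ) ^ 2)⁻¹ ∂μ :=
    setIntegral_mono_on (hint 0).integrableOn (integrable_const _) hAm fun ω hω =>
      excursionProc_zero_le (hcont ω) hr hq1 (ENNReal.coe_toNNReal (hAfin ω hω)).symm
  have hiD : IntegrableOn (D.indicator fun _ => ((r : ℝ) ^ 2)⁻¹) A μ :=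
    ((integrable_const _).indicator hDm).integrableOn
  have hiC : IntegrableOn (fun _ : Ω => (C : ℝ) * (t * ((r : ℝ) ^ 4)⁻¹)) A μ :=
    integrable_const _
  have h3 : ∫ ω in A, (D.indicator (fun _ => ((r : ℝ) ^ 2)⁻¹) ω
      - (C : ℝ) * (t * ((r : ℝ) ^ 4)⁻¹)) ∂μ ≤ ∫ ω in A, excursionProc κ C r q t ω ∂μ :=
    setIntegral_mono_on (hiD.sub hiC) (hint t).integrableOn hAm fun ω hω =>
      le_excursionProc (hcont ω) hr hq hq1 (ENNReal.coe_toNNReal (hAfin ω hω)).symm t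
  rw [integral_sub hiD hiC, setIntegral_indicator hDm] at h3
  simp only [setIntegral_const, smul_eq_mul] at h2 h3
  have hsplit : μ.real A = μ.real (A ∩ D) +
      μ.real (A ∩ {ω | rhoRq κ r q ω + t ≤ lamAfterRho κ r q ω}) := by
    rw [← measureReal_inter_add_sdiff (s := A) hDm]
    congr 2
    ext ω
    simp [hD]
  have hr' : (0 : ℝ) < r := hr
  have hq1' : (q : ℝ) < 1 := hq1
  have hC' : (C : ℝ) * t ≤ q * (1 - q) * (r : ℝ) ^ 2 := by
    have := NNReal.coe_le_coe.2 ht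
    rwa [NNReal.coe_mul, NNReal.coe_mul, NNReal.coe_mul, NNReal.coe_sub hq1.le, NNReal.coe_pow,
      NNReal.coe_one] at this
  have hR : (((r / (1 - q) : ℝ≥0) : ℝ) ^ 2)⁻¹ = (1 - (q : ℝ)) ^ 2 * ((r : ℝ) ^ 2)⁻¹ := by
    rw [NNReal.coe_div, NNReal.coe_sub hq1.le, NNReal.coe_one, div_pow, inv_div, div_eq_mul_inv]
  have hCt : (C : ℝ) * (t * ((r : ℝ) ^ 4)⁻¹) ≤ q * (1 - q) * ((r : ℝ) ^ 2)⁻¹ := by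
    rw [← mul_assoc, ← div_eq_mul_inv, ← div_eq_mul_inv,
      div_le_div_iff₀ (by positivity) (by positivity)]
    nlinarith [mul_le_mul_of_nonneg_right hC' (by positivity : 0 ≤ (r : ℝ) ^ 2)]
  rw [hR] at h2
  have hA0 : 0 ≤ μ.real A := measureReal_nonneg
  have h4 := mul_le_mul_of_nonneg_left hCt hA0
  have h5 : μ.real (A ∩ D) * ((r : ℝ) ^ 2)⁻¹ ≤ ((1 - q) * μ.real A) * ((r : ℝ) ^ 2)⁻¹ := by
    nlinarith
  have h6 := le_of_mul_le_mul_right h5 (by positivity)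
  linarith

/-- If the σ-algebra generated by the sets of `F_ρ` is not contained in the ambient one, then some
non-measurable set is contained in `{ρ = ∞}`. -/
theorem exists_not_measurableSet_of_not_stoppedSigma_le {T : Ω → ℝ≥0∞}
    (h : ¬ stoppedSigma ℱ T ≤ m0) :
    ∃ N ⊆ {ω | T ω = ⊤}, ¬ MeasurableSet N := by
  rw [stoppedSigma, MeasurableSpace.generateFrom_le_iff] at h
  obtain ⟨A, hA, hAm⟩ := not_subset.1 h
  refine ⟨A ∩ {ω | T ω = ⊤}, inter_subset_right, fun hN => hAm ?_⟩
  have heq : A = (A ∩ {ω | T ω = ⊤}) ∪ ⋃ n : ℕ, A ∩ {ω | T ω ≤ ((n : ℝ≥0) : ℝ≥0∞)} := by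
    rw [← inter_iUnion, ← inter_union_distrib_left, eq_comm, inter_eq_left]
    intro ω _
    by_cases htop : T ω = ⊤
    · exact Or.inl htop
    · obtain ⟨n, hn⟩ := ENNReal.exists_nat_gt htop
      exact Or.inr (mem_iUnion.2 ⟨n, by simpa using hn.le⟩)
  change MeasurableSet A
  rw [heq]
  exact hN.union (MeasurableSet.iUnion fun n => ℱ.le _ _ (hA n))

/-- If `{T = ∞}` has a non-measurable subset, the supermartingale inequality with respect to
`F_T` reduces to non-negativity, as the conditional expectation is `0` by convention. -/
theorem ae_nonneg_of_not_measurableSet {T : Ω → ℝ≥0∞} {f g : Ω → ℝ} {N : Set Ω}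
    (hN : N ⊆ {ω | T ω = ⊤}) (hNm : ¬ MeasurableSet N)
    (hfg : μ[f | stoppedSigma ℱ T] ≤ᵐ[μ] g) : 0 ≤ᵐ[μ] g := by
  have hmem : MeasurableSet[stoppedSigma ℱ T] N := by
    refine MeasurableSpace.measurableSet_generateFrom fun t => ?_
    have : N ∩ {ω | T ω ≤ (t : ℝ≥0∞)} = ∅ := by
      ext ω
      simp only [mem_inter_iff, mem_ofPred_eq, mem_empty_iff_false, iff_false, not_and]
      intro hω
      simp [show T ω = ⊤ from hN hω]
    rw [this]
    exact @MeasurableSet.empty _ (ℱ t)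
  rwa [condExp_of_not_le fun hle => hNm (hle _ hmem)] at hfg

/-- If every excursion process started at the first passage time of `R` is non-negative, then
almost surely `R` is not reached before `ℓ`. -/
theorem measure_rhoZero_lt_lamZero_eq_zero [IsFiniteMeasure μ] {p : ℝ} (hp : 0 < p)
    {ℓ R : ℝ≥0} (hℓR : ℓ < R) (hC : 0 < C)
    (hadapt : ∀ t : ℝ≥0, Measurable[ℱ t] (κ t)) (hcont : ∀ ω, Continuous fun t => κ t ω)
    (hfin : ∀ R, ∀ᵐ ω ∂μ, rhoZero κ R ω ≠ ⊤)
    (hsub : ∀ R : ℝ≥0, ℓ < R →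
      Submartingale
        (fun (t : ℝ≥0) ω =>
          (κ ((min ((t : ℝ≥0) : ℝ≥0∞) (min (lamZero κ ℓ ω) (rhoZero κ R ω))).toNNReal) ω
            : ℝ) ^ p) ℱ μ)
    (hpos : ∀ r q : ℝ≥0, ℓ < r → 0 < q → q < 1 → r / (1 - q) = R → ∀ s : ℝ≥0,
      0 ≤ᵐ[μ] excursionProc κ C r q s) :
    μ {ω | rhoZero κ R ω < lamZero κ ℓ ω} = 0 := by
  set d := TopologicalSpace.denseSeq ℝ≥0 with hd
  have hdense : DenseRange d := TopologicalSpace.denseRange_denseSeq ℝ≥0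
  have hR0 : 0 < R := pos_of_gt hℓR
  have hae : ∀ᵐ ω ∂μ, ∀ k i : ℕ, ℓ < d k → d k < R →
      0 ≤ excursionProc κ C (d k) (1 - d k / R) (d i) ω := by
    refine ae_all_iff.2 fun k => ae_all_iff.2 fun i => ?_
    by_cases hk : ℓ < d k ∧ d k < R
    · have hlt1 : d k / R < 1 := (div_lt_one hR0).2 hk.2
      have hk0 : 0 < d k := pos_of_gt hk.1
      filter_upwards [hpos (d k) (1 - d k / R) hk.1 (tsub_pos_of_lt hlt1)
        (tsub_lt_self one_pos (div_pos hk0 hR0))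
        (by rw [tsub_tsub_cancel_of_le hlt1.le, div_div_cancel₀ hk0.ne']) (d i)] with ω hω _ _
      exact hω
    · exact Eventually.of_forall fun ω h1 h2 => absurd ⟨h1, h2⟩ hk
  have hnull : ∀ i j K : ℕ, d i < d j → 0 < K →
      μ (({ω | rhoZero κ R ω ≤ d i} ∩ {ω | (d j : ℝ≥0∞) < lamZero κ ℓ ω}) ∩
        {ω | (d j : ℝ≥0∞) < rhoZero κ K ω}) = 0 := by
    intro i j K hij hK0
    obtain ⟨n, hnR, hnK, hn⟩ : ∃ n : ℕ, R < n ∧ K ≤ n ∧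
        (((n : ℝ) / 2) ^ 2)⁻¹ < (C : ℝ) * (((K : ℝ) ^ 4)⁻¹ * (d j - d i)) := by
      have hpos : 0 < (C : ℝ) * (((K : ℝ) ^ 4)⁻¹ * (d j - d i)) := by
        have h1 : (d i : ℝ) < d j := hij
        have h2 : (0 : ℝ) < C := hC
        have h3 : (0 : ℝ) < K := Nat.cast_pos.2 hK0
        exact mul_pos h2 (mul_pos (by positivity) (sub_pos.2 h1))
      have hlim : Tendsto (fun n : ℕ => (((n : ℝ) / 2) ^ 2)⁻¹) atTop (nhds 0) :=
        ((tendsto_pow_atTop two_ne_zero).comp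
          (tendsto_natCast_atTop_atTop.atTop_div_const two_pos)).inv_tendsto_atTop
      exact ((tendsto_natCast_atTop_atTop.eventually_gt_atTop R).and
        ((eventually_ge_atTop K).and (hlim.eventually_lt_const hpos))).exists
    have hdm : ∀ K : ℕ, K ≤ n → ∀ ω, (d j : ℝ≥0∞) < rhoZero κ K ω →
        (d j : ℝ≥0∞) < rhoZero κ n ω := fun K hK ω h =>
      (lt_rhoZero_iff (hcont ω) _).2 fun s hs =>
        ((lt_rhoZero_iff (hcont ω) _).1 h s hs).trans_le (Nat.cast_le.2 hK)
    refine measure_eq_zero_of_inter_eq_zero (t := d j) (R := n) hp hadapt hcont (hfin n)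
      (hsub n (hℓR.trans hnR)) ?_ (fun ω hω => ⟨hω.1.2, hdm K hnK ω hω.2⟩) ?_
    · exact ((ℱ.mono hij.le _ (measurableSet_rhoZero_le hadapt hcont R _)).inter
        (measurableSet_lt_lamZero hadapt hcont ℓ _)).inter
        (measurableSet_lt_rhoZero hadapt hcont _ _)
    refine measure_mono_null ?_ (ae_iff.1 hae)
    rintro ω ⟨⟨⟨hρ, hjl⟩, hjK⟩, hnl⟩ hω
    have hc := hcont ω
    obtain ⟨a, ha⟩ : ∃ a : ℝ≥0, rhoZero κ R ω = a :=
      ⟨_, (ENNReal.coe_toNNReal (ne_top_of_le_ne_top ENNReal.coe_ne_top hρ)).symm⟩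
    obtain ⟨c, hcn⟩ : ∃ c : ℝ≥0, rhoZero κ n ω = c := ⟨_, (ENNReal.coe_toNNReal hnl.ne_top).symm⟩
    have hai : a ≤ d i := by simpa [ha] using hρ
    have hjc : d j < c := by simpa [hcn] using hdm K hnK ω hjK
    rw [mem_ofPred_eq, hcn] at hnl
    obtain ⟨c', hcc', hc'⟩ := ENNReal.lt_iff_exists_nnreal_btwn.1 hnl
    rw [ENNReal.coe_lt_coe] at hcc'
    -- a level strictly between `ℓ` and the minimum of the path on `[0, c']`
    obtain ⟨x, hx, hmin⟩ := isCompact_Icc.exists_isMinOn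
      (⟨0, left_mem_Icc.2 zero_le⟩ : (Icc 0 c').Nonempty) hc.continuousOn
    have hℓx : ℓ < κ x ω := (lt_lamZero_iff hc c').1 hc' x hx.2
    obtain ⟨k, hk⟩ := hdense.exists_mem_open isOpen_Ioo (nonempty_Ioo.2 (lt_min hℓx hℓR))
    obtain ⟨hk1, hk2⟩ := hk
    -- a time close to the first passage time of `n`
    have hopen : IsOpen {s : ℝ≥0 | d j < a + s ∧ a + s < c' ∧ (n : ℝ≥0) / 2 < κ (a + s) ω} := by
      have hadd : Continuous fun s : ℝ≥0 => a + s := by fun_prop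
      have hκadd : IsOpen {s : ℝ≥0 | (n : ℝ≥0) / 2 < κ (a + s) ω} :=
        isOpen_lt continuous_const (hc.comp hadd)
      exact (isOpen_lt continuous_const hadd).inter ((isOpen_lt hadd continuous_const).inter hκadd)
    have hac : a ≤ c := hai.trans (hij.le.trans hjc.le)
    have hκc : (n : ℝ≥0) ≤ κ c ω := le_of_rhoZero_eq hc hcn
    have hn0 : (0 : ℝ≥0) < n := hR0.trans hnR
    obtain ⟨m, hm1, hm2, hm3⟩ := hdense.exists_mem_open hopen ⟨c - a, by
      simp only [mem_ofPred_eq, add_tsub_cancel_of_le hac]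
      exact ⟨hjc, hcc', (half_lt_self hn0).trans_le hκc⟩⟩
    have hkR : d k < R := hk2.trans_le (min_le_right _ _)
    have hk0 : 0 < d k := pos_of_gt hk1
    have hRq : rhoRq κ (d k) (1 - d k / R) ω = a := by
      have : d k / (1 - (1 - d k / R)) = R := by
        rw [tsub_tsub_cancel_of_le ((div_lt_one hR0).2 hkR).le, div_div_cancel₀ hk0.ne']
      rw [rhoRq, this]
      exact ha
    have hle := excursionProc_le (C := C) (K := K) (b := d j) hc hk0 hRq (s := d m)
      ((add_lt_hitBelow_iff hc hRq _).2 fun u hu => (hk2.trans_le (min_le_left _ _)).trans_le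
        (hmin ⟨zero_le, (add_le_add_right hu a).trans hm2.le⟩))
      (hai.trans hij.le) hm1.le (fun u hu => ((lt_rhoZero_iff hc _).1 hjK u hu).le)
    have h0 := hω k m hk1 hkR
    have h1 : ((κ (a + d m) ω : ℝ) ^ 2)⁻¹ ≤ (((n : ℝ) / 2) ^ 2)⁻¹ := by
      have h2 : (n : ℝ) / 2 ≤ κ (a + d m) ω := by
        have := NNReal.coe_le_coe.2 hm3.le
        simpa using this
      have hn0' : (0 : ℝ) < n := by exact_mod_cast hn0
      exact inv_anti₀ (by positivity) (by gcongr)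
    have h3 : (C : ℝ) * (((K : ℝ) ^ 4)⁻¹ * (d j - d i)) ≤
        (C : ℝ) * (((K : ℝ) ^ 4)⁻¹ * (d j - a)) := by
      have : (a : ℝ) ≤ d i := hai
      gcongr
    rw [NNReal.coe_natCast] at hle
    linarith
  refine measure_mono_null (t := ⋃ i, ⋃ j, ⋃ K : ℕ, {ω | (d i < d j ∧ 0 < K) ∧
      ω ∈ ({ω | rhoZero κ R ω ≤ d i} ∩ {ω | (d j : ℝ≥0∞) < lamZero κ ℓ ω}) ∩
        {ω | (d j : ℝ≥0∞) < rhoZero κ K ω}}) ?_ ?_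
  · intro ω hω
    obtain ⟨x, hx1, hx2⟩ := ENNReal.lt_iff_exists_nnreal_btwn.1 hω
    obtain ⟨y, hy1, hy2⟩ := ENNReal.lt_iff_exists_nnreal_btwn.1 hx2
    rw [ENNReal.coe_lt_coe] at hy1
    obtain ⟨i, hi1, hi2⟩ := hdense.exists_mem_open isOpen_Ioo (nonempty_Ioo.2 hy1)
    obtain ⟨j, hj1, hj2⟩ := hdense.exists_mem_open isOpen_Ioo (nonempty_Ioo.2 hi2)
    obtain ⟨z, hz, hmax⟩ := isCompact_Icc.exists_isMaxOn
      (⟨0, left_mem_Icc.2 zero_le⟩ : (Icc 0 (d j)).Nonempty) (hcont ω).continuousOn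
    obtain ⟨K, hK⟩ := exists_nat_gt (κ z ω)
    simp only [mem_iUnion]
    refine ⟨i, j, K, ⟨hj1, Nat.cast_pos.1 (pos_of_gt hK)⟩,
      ⟨(hx1.trans (ENNReal.coe_lt_coe.2 hi1)).le,
      (ENNReal.coe_lt_coe.2 hj2).trans hy2⟩, ?_⟩
    exact (lt_rhoZero_iff (hcont ω) _).2 fun s hs => (hmax ⟨zero_le, hs⟩).trans_lt hK
  · refine measure_iUnion_null fun i => measure_iUnion_null fun j => measure_iUnion_null fun K => ?_
    by_cases hij : d i < d j ∧ 0 < K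
    · exact measure_mono_null (fun ω hω => hω.2) (hnull i j K hij.1 hij.2)
    · simp [hij]

end Supermartingale

end HittingTimes

theorem le_condExp_of_forall_setIntegral_le {m m0 : MeasurableSpace Ω} {μ : Measure Ω}
    [IsFiniteMeasure μ] (hm : m ≤ m0) {f g : Ω → ℝ} (hf : Integrable f μ)
    (hg : StronglyMeasurable[m] g) (hgi : Integrable g μ)
    (h : ∀ B, MeasurableSet[m] B → ∫ ω in B, g ω ∂μ ≤ ∫ ω in B, f ω ∂μ) :
    g ≤ᵐ[μ] μ[f | m] := by
  refine ae_le_of_ae_le_trim (hm := hm) (ae_le_of_forall_setIntegral_le (hgi.trim hm hg)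
    (integrable_condExp.trim hm stronglyMeasurable_condExp) fun B hB _ => ?_)
  rw [← setIntegral_trim hm hg hB, ← setIntegral_trim hm stronglyMeasurable_condExp hB,
    setIntegral_condExp hm hf hB]
  exact h B hB

/-- **Lower bound for additive functionals up to return times** (Lemma 3.7): under the
submartingale condition (a) on `κ^p` stopped at `λ_ℓ ∧ ρ_r` and the supermartingale
condition (b) on excursions above level `r`, for every non-decreasing measurable
`h : [0,∞) → [0,∞)`, every `r ∈ (ℓ,∞)`, `q ∈ (0,1)` and `ε ∈ (0, C⁻¹ q(1−q)]`, almost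
surely on `{κ₀ > ℓ}`,
`P(∫₀^{λ_ℓ} h(κ_s) ds ≥ ε h(r) r² | F₀) ≥ q min{(κ₀^p − ℓ^p)(1−q)^p r^{−p}, 1}`. -/
theorem additive_functional_lower_bound
    {m0 : MeasurableSpace Ω} {μ : Measure Ω} [IsProbabilityMeasure μ]
    (ℱ : Filtration ℝ≥0 m0)
    (κ : ℝ≥0 → Ω → ℝ≥0)
    (hadapt : ∀ t : ℝ≥0, Measurable[ℱ t] (κ t))
    (hcont : ∀ ω, Continuous fun t => κ t ω)
    (hlimsup : ∀ᵐ ω ∂μ, Filter.limsup (fun t => (κ t ω : ℝ≥0∞)) atTop = ⊤)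
    (p : ℝ) (hp : 0 < p) (ℓ C : ℝ≥0) (hℓ : 0 < ℓ) (hC : 0 < C)
    (hsub : ∀ r : ℝ≥0, ℓ < r →
      Submartingale
        (fun (t : ℝ≥0) ω =>
          (κ ((min ((t : ℝ≥0) : ℝ≥0∞) (min (lamZero κ ℓ ω) (rhoZero κ r ω))).toNNReal) ω
            : ℝ) ^ p)
        ℱ μ)
    (hexc : ∀ r : ℝ≥0, ℓ < r → ∀ q : ℝ≥0, 0 < q → q < 1 →
      (∀ t : ℝ≥0, Integrable (excursionProc κ C r q t) μ) ∧
      ∀ s t : ℝ≥0, s ≤ t →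
        μ[excursionProc κ C r q t |
            stoppedSigma ℱ (fun ω => rhoRq κ r q ω + (s : ℝ≥0∞))]
          ≤ᵐ[μ] excursionProc κ C r q s)
    (h : ℝ≥0 → ℝ≥0) (hmono : Monotone h) (hmeas : Measurable h) :
    ∀ r : ℝ≥0, ℓ < r → ∀ q : ℝ≥0, 0 < q → q < 1 →
      ∀ ε : ℝ≥0, 0 < ε → ε ≤ C⁻¹ * q * (1 - q) →
        ∀ᵐ ω ∂μ, ℓ < κ 0 ω →
          (q : ℝ) * min (((κ 0 ω : ℝ) ^ p - (ℓ : ℝ) ^ p) * (1 - (q : ℝ)) ^ p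
              * ((r : ℝ) ^ p)⁻¹) 1
            ≤ (μ[Set.indicator
                  {ω' | ((ε * h r * r ^ 2 : ℝ≥0) : ℝ≥0∞) ≤ addFunToLam κ h ℓ ω'}
                  (fun _ => (1 : ℝ)) | ℱ 0]) ω := by
  intro r hr q hq hq1 ε _ hεC
  have hr0 : 0 < r := pos_of_gt hr
  have hrR : r < r / (1 - q) := lt_div_one_sub hr0 hq hq1
  have hfin := ae_rhoZero_ne_top hcont hlimsup
  by_cases hle : stoppedSigma ℱ (rhoRq κ r q) ≤ m0
  · have hsup := (hexc r hr q hq hq1).2 0 (ε * r ^ 2) zero_le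
    simp only [ENNReal.coe_zero, add_zero] at hsup
    have hCε : C * (ε * r ^ 2) ≤ q * (1 - q) * r ^ 2 :=
      calc C * (ε * r ^ 2) ≤ C * (C⁻¹ * q * (1 - q) * r ^ 2) := by gcongr
        _ = q * (1 - q) * r ^ 2 := by
          rw [mul_assoc C⁻¹, mul_assoc C⁻¹, mul_inv_cancel_left₀ hC.ne']
    have hE : MeasurableSet {ω | ((ε * h r * r ^ 2 : ℝ≥0) : ℝ≥0∞) ≤ addFunToLam κ h ℓ ω} :=
      measurableSet_le measurable_const (measurable_addFunToLam hadapt hcont hmeas ℓ)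
    have hS : MeasurableSet[ℱ 0] {ω | ℓ < κ 0 ω} :=
      hadapt 0 measurableSet_Ioi
    have hg : StronglyMeasurable[ℱ 0] ({ω | ℓ < κ 0 ω}.indicator fun ω => (q : ℝ) *
        min (((κ 0 ω : ℝ) ^ p - (ℓ : ℝ) ^ p) * (((r / (1 - q) : ℝ≥0) : ℝ) ^ p)⁻¹) 1) := by
      refine StronglyMeasurable.indicator ?_ hS
      have := (((hadapt 0).coe_nnreal_real.pow_const p).sub_const ((ℓ : ℝ) ^ p)).mul_const
        (((r / (1 - q) : ℝ≥0) : ℝ) ^ p)⁻¹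
      exact ((this.min measurable_const).const_mul _).stronglyMeasurable
    have hgi : Integrable ({ω | ℓ < κ 0 ω}.indicator fun ω => (q : ℝ) *
        min (((κ 0 ω : ℝ) ^ p - (ℓ : ℝ) ^ p) * (((r / (1 - q) : ℝ≥0) : ℝ) ^ p)⁻¹) 1) μ := by
      refine Integrable.of_bound (hg.mono (ℱ.le 0)).aestronglyMeasurable q
        (Eventually.of_forall fun ω => ?_)
      by_cases hω : ω ∈ {ω | ℓ < κ 0 ω}
      · have h1 : 0 ≤ (κ 0 ω : ℝ) ^ p - (ℓ : ℝ) ^ p :=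
          sub_nonneg.2 (Real.rpow_le_rpow ℓ.2 (NNReal.coe_le_coe.2 (le_of_lt hω)) hp.le)
        have h2 : 0 ≤ min (((κ 0 ω : ℝ) ^ p - (ℓ : ℝ) ^ p)
            * (((r / (1 - q) : ℝ≥0) : ℝ) ^ p)⁻¹) 1 := le_min (by positivity) zero_le_one
        rw [indicator_of_mem hω, Real.norm_of_nonneg (by positivity)]
        exact mul_le_of_le_one_right q.2 (min_le_right _ _)
      · rw [indicator_of_notMem hω, norm_zero]
        exact q.2
    have hmain := le_condExp_of_forall_setIntegral_le (ℱ.le 0) ((integrable_const (1 : ℝ)).indicator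
      hE) hg hgi fun B hB => ?_
    · filter_upwards [hmain] with ω hω hℓω
      rw [indicator_of_mem (show ω ∈ {ω | ℓ < κ 0 ω} from hℓω)] at hω
      have hq1' : 0 ≤ 1 - (q : ℝ) := sub_nonneg.2 (NNReal.coe_le_coe.2 hq1.le)
      have hRp : (((r / (1 - q) : ℝ≥0) : ℝ) ^ p)⁻¹ = (1 - (q : ℝ)) ^ p * ((r : ℝ) ^ p)⁻¹ := by
        rw [NNReal.coe_div, NNReal.coe_sub hq1.le, NNReal.coe_one,
          Real.div_rpow r.coe_nonneg hq1', inv_div, div_eq_mul_inv]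
      rwa [hRp, ← mul_assoc] at hω
    have hA : MeasurableSet[stoppedSigma ℱ (rhoRq κ r q)]
        ((B ∩ {ω | ℓ < κ 0 ω}) ∩ {ω | rhoZero κ (r / (1 - q)) ω < lamZero κ ℓ ω}) :=
      MeasurableSpace.measurableSet_generateFrom fun t => by
        rw [inter_assoc]
        exact (ℱ.mono zero_le _ (hB.inter hS)).inter
          (measurableSet_rhoZero_lt_lamZero_inter hadapt hcont _ ℓ t)
    calc ∫ ω in B, {ω | ℓ < κ 0 ω}.indicator (fun ω => (q : ℝ) *
        min (((κ 0 ω : ℝ) ^ p - (ℓ : ℝ) ^ p) * (((r / (1 - q) : ℝ≥0) : ℝ) ^ p)⁻¹) 1) ω ∂μ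
        = q * ∫ ω in B ∩ {ω | ℓ < κ 0 ω},
          min (((κ 0 ω : ℝ) ^ p - (ℓ : ℝ) ^ p) * (((r / (1 - q) : ℝ≥0) : ℝ) ^ p)⁻¹) 1 ∂μ := by
          rw [setIntegral_indicator (ℱ.le 0 _ hS), integral_const_mul]
      _ ≤ q * μ.real ((B ∩ {ω | ℓ < κ 0 ω}) ∩
          {ω | rhoZero κ (r / (1 - q)) ω < lamZero κ ℓ ω}) := by
          gcongr
          exact setIntegral_min_le hp (hr.trans hrR) hadapt hcont (hfin _)
            (hsub _ (hr.trans hrR)) (hB.inter hS) fun ω hω => hω.2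
      _ ≤ μ.real (((B ∩ {ω | ℓ < κ 0 ω}) ∩ {ω | rhoZero κ (r / (1 - q)) ω < lamZero κ ℓ ω}) ∩
          {ω | rhoRq κ r q ω + (ε * r ^ 2 : ℝ≥0) ≤ lamAfterRho κ r q ω}) :=
          mul_measureReal_le_of_stoppedSigma_le hadapt hcont hr0 hq hq1 hle
            (hexc r hr q hq hq1).1 hsup hA (fun ω hω => hω.2.ne_top) hCε
      _ ≤ μ.real (B ∩ {ω | ((ε * h r * r ^ 2 : ℝ≥0) : ℝ≥0∞) ≤ addFunToLam κ h ℓ ω}) := by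
          refine measureReal_mono fun ω hω => ⟨hω.1.1.1, ?_⟩
          have hρ : rhoRq κ r q ω < lamZero κ ℓ ω := hω.1.2
          have := mul_le_addFunToLam (hcont ω) hmono hr
            (ENNReal.coe_toNNReal hρ.ne_top).symm hρ hω.2
          rwa [mul_right_comm] at this
      _ = _ := by
          rw [setIntegral_indicator hE, setIntegral_const, smul_eq_mul, mul_one]
  · obtain ⟨N, hN, hNm⟩ := exists_not_measurableSet_of_not_stoppedSigma_le hle
    have hnull := measure_rhoZero_lt_lamZero_eq_zero hp (hr.trans hrR) hC hadapt hcont hfin hsub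
      fun r' q' hr' hq' hq1' hR s => ae_nonneg_of_not_measurableSet
        (T := fun ω => rhoRq κ r' q' ω + s) (N := N) (fun ω hω => by
          have : rhoRq κ r q ω = ⊤ := hN hω
          rw [rhoRq, ← hR] at this
          simp [rhoRq, this]) hNm
        ((hexc r' hr' q' hq' hq1').2 s s le_rfl)
    have h0 : μ ({ω | ((0 : ℝ≥0) : ℝ≥0∞) < lamZero κ ℓ ω} ∩
        {ω | ((0 : ℝ≥0) : ℝ≥0∞) < rhoZero κ (r / (1 - q)) ω}) = 0 :=
      measure_eq_zero_of_inter_eq_zero hp hadapt hcont (hfin _) (hsub _ (hr.trans hrR))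
        ((measurableSet_lt_lamZero hadapt hcont _ _).inter
          (measurableSet_lt_rhoZero hadapt hcont _ _)) (fun ω hω => hω)
        (measure_mono_null inter_subset_right hnull)
    filter_upwards [measure_eq_zero_iff_ae_notMem.1 h0, measure_eq_zero_iff_ae_notMem.1 hnull]
      with ω hω1 hω2 hℓω
    have hlam : ((0 : ℝ≥0) : ℝ≥0∞) < lamZero κ ℓ ω := (lt_lamZero_iff (hcont ω) 0).2 fun s hs => by
      rwa [nonpos_iff_eq_zero.1 hs]
    refine absurd ⟨hlam, ?_⟩ hω1
    exact hlam.trans_le (not_lt.1 hω2)
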